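/- Suppose the initial data satisfy B_ππ = A ∘ B_φφ, B_φπ = (i/2)·Id and B_πφ = −(i/2)·Id. Then for all t, t′ ∈ ℝ, G(t,t′) = cfc(x ↦ cos((t−t′)√x), A) ∘ B_φφ − (i/2)·cfc(x ↦ sin((t−t′)√x)/√x, A); in particular G(t+s, t′+s) = G(t, t′) for all t, t′, s ∈ ℝ, i.e. G depends only on the time difference t−t′. -/

import Mathlib

theorem continuousOn_sin_mul_sqrt_div_sqrt {s : Set ℝ} (hs : ∀ x ∈ s, 0 < x) (t : ℝ) :
    ContinuousOn (fun x : ℝ => Real.sin (t * Real.sqrt x) / Real.sqrt x) s :=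
  ContinuousOn.div (by fun_prop) (by fun_prop) fun x hx => (Real.sqrt_pos.2 (hs x hx)).ne'

section ContinuousFunctionalCalculus

variable {R : Type*} [Ring R] [StarRing R] [TopologicalSpace R] [Algebra ℝ R]
  [ContinuousFunctionalCalculus ℝ R IsSelfAdjoint]

/-- The addition formula for `cos (t * √a)`. -/
theorem cfc_cos_sub_mul_sqrt {a : R} (ha : IsSelfAdjoint a) (hpos : ∀ x ∈ spectrum ℝ a, 0 < x)
    (t u : ℝ) :
    cfc (fun x : ℝ => Real.cos ((t - u) * Real.sqrt x)) a =
      cfc (fun x : ℝ => Real.cos (t * Real.sqrt x)) a *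
        cfc (fun x : ℝ => Real.cos (u * Real.sqrt x)) a +
      cfc (fun x : ℝ => Real.sin (t * Real.sqrt x) / Real.sqrt x) a *
        (cfc (fun x : ℝ => Real.sin (u * Real.sqrt x) / Real.sqrt x) a * a) := by
  have hS := continuousOn_sin_mul_sqrt_div_sqrt hpos
  have hC (r : ℝ) : ContinuousOn (fun x : ℝ => Real.cos (r * Real.sqrt x)) (spectrum ℝ a) := by
    fun_prop
  have hid : ContinuousOn (fun x : ℝ => x) (spectrum ℝ a) := continuousOn_id
  conv_rhs => enter [2, 2, 2]; rw [← cfc_id' ℝ a ha]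
  rw [← cfc_mul _ _ a (hC t) (hC u), ← cfc_mul _ _ a (hS u) hid,
    ← cfc_mul _ _ a (hS t) ((hS u).fun_mul hid),
    ← cfc_add a _ _ ((hC t).fun_mul (hC u)) ((hS t).fun_mul ((hS u).fun_mul hid))]
  refine cfc_congr fun x hx => ?_
  have hx0 : Real.sqrt x ≠ 0 := (Real.sqrt_pos.2 (hpos x hx)).ne'
  have hsq : Real.sqrt x ^ 2 = x := Real.sq_sqrt (hpos x hx).le
  simp only [sub_mul, Real.cos_sub]
  congr 1
  field_simp
  rw [hsq]
  ring

/-- The addition formula for `sin (t * √a) / √a`. -/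
theorem cfc_sin_sub_mul_sqrt_div_sqrt {a : R} (hpos : ∀ x ∈ spectrum ℝ a, 0 < x) (t u : ℝ) :
    cfc (fun x : ℝ => Real.sin ((t - u) * Real.sqrt x) / Real.sqrt x) a =
      cfc (fun x : ℝ => Real.sin (t * Real.sqrt x) / Real.sqrt x) a *
        cfc (fun x : ℝ => Real.cos (u * Real.sqrt x)) a -
      cfc (fun x : ℝ => Real.cos (t * Real.sqrt x)) a *
        cfc (fun x : ℝ => Real.sin (u * Real.sqrt x) / Real.sqrt x) a := by
  have hS := continuousOn_sin_mul_sqrt_div_sqrt hpos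
  have hC (r : ℝ) : ContinuousOn (fun x : ℝ => Real.cos (r * Real.sqrt x)) (spectrum ℝ a) := by
    fun_prop
  rw [← cfc_mul _ _ a (hS t) (hC u), ← cfc_mul _ _ a (hC t) (hS u),
    ← cfc_sub _ _ a ((hS t).fun_mul (hC u)) ((hC t).fun_mul (hS u))]
  refine cfc_congr fun x _ => ?_
  simp only [sub_mul, Real.sin_sub]
  ring

end ContinuousFunctionalCalculus

/-- **Stationary closed form of time-translation invariant Wightman functions
(converse direction).**  With `A`, `Bφφ, Bφπ, Bπφ, Bππ` and
`G t t' = C_t ∘ C_{t'} ∘ Bφφ + C_t ∘ S_{t'} ∘ Bφπ + S_t ∘ C_{t'} ∘ Bπφ + S_t ∘ S_{t'} ∘ Bππ`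
as in the paper, if `Bππ = A ∘ Bφφ`, `Bφπ = (i/2)·Id` and `Bπφ = −(i/2)·Id`, then
`G t t' = cfc (cos ((t−t')√·)) A ∘ Bφφ − (i/2)·cfc (sin ((t−t')√·)/√·) A`,
and in particular `G (t+s) (t'+s) = G t t'` for all `t, t', s`. -/
theorem stationary_wightman_closed_form
    {H : Type*} [NormedAddCommGroup H] [InnerProductSpace ℂ H]
    [CompleteSpace H] [Nontrivial H]
    (A : H →L[ℂ] H) (hA : IsSelfAdjoint A)
    (c : ℝ) (hc : 0 < c) (hspec : spectrum ℝ A ⊆ Set.Ici c)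
    (Bφφ Bφπ Bπφ Bππ : H →L[ℂ] H)
    (G : ℝ → ℝ → H →L[ℂ] H)
    (hG : ∀ t t' : ℝ, G t t' =
      cfc (fun x : ℝ => Real.cos (t * Real.sqrt x)) A *
        (cfc (fun x : ℝ => Real.cos (t' * Real.sqrt x)) A * Bφφ) +
      cfc (fun x : ℝ => Real.cos (t * Real.sqrt x)) A *
        (cfc (fun x : ℝ => Real.sin (t' * Real.sqrt x) / Real.sqrt x) A * Bφπ) +
      cfc (fun x : ℝ => Real.sin (t * Real.sqrt x) / Real.sqrt x) A *
        (cfc (fun x : ℝ => Real.cos (t' * Real.sqrt x)) A * Bπφ) +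
      cfc (fun x : ℝ => Real.sin (t * Real.sqrt x) / Real.sqrt x) A *
        (cfc (fun x : ℝ => Real.sin (t' * Real.sqrt x) / Real.sqrt x) A * Bππ))
    (hππ : Bππ = A * Bφφ)
    (hφπ : Bφπ = (Complex.I / 2) • (1 : H →L[ℂ] H))
    (hπφ : Bπφ = -((Complex.I / 2) • (1 : H →L[ℂ] H))) :
    (∀ t t' : ℝ, G t t' =
      cfc (fun x : ℝ => Real.cos ((t - t') * Real.sqrt x)) A * Bφφ -
        (Complex.I / 2) •
          cfc (fun x : ℝ => Real.sin ((t - t') * Real.sqrt x) / Real.sqrt x) A) ∧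
    (∀ t t' s : ℝ, G (t + s) (t' + s) = G t t') := by
  have hpos : ∀ x ∈ spectrum ℝ A, 0 < x := fun x hx => hc.trans_le (hspec hx)
  have closed (t t' : ℝ) : G t t' =
      cfc (fun x : ℝ => Real.cos ((t - t') * Real.sqrt x)) A * Bφφ -
        (Complex.I / 2) •
          cfc (fun x : ℝ => Real.sin ((t - t') * Real.sqrt x) / Real.sqrt x) A := by
    rw [hG, cfc_cos_sub_mul_sqrt hA hpos, cfc_sin_sub_mul_sqrt_div_sqrt hpos, hππ, hφπ, hπφ]
    simp only [mul_neg, mul_smul_comm, mul_one, add_mul, mul_assoc, smul_sub]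
    abel
  refine ⟨closed, fun t t' s => ?_⟩
  rw [closed, closed, add_sub_add_right_eq_sub]
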